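/- There exists a constant D > 0 such that the following holds for all sufficiently large n: suppose n^{1/10} ≤ k ≤ n^{9/10}, and let α_1, …, α_r and β_1, …, β_r be reals with α_i, β_i ∈ [n^{-1/100}, n^{1/100}] for each i, such that m_i := α_i · (n/k) and n_i := β_i · (n/k) are positive integers for each i. Set p_i = α_i/(α_i + β_i) and let H(p) = −p log p − (1−p) log(1−p) be the binary entropy function. If the sequence of pairs ((m_1, n_1), (m_2, n_2), …, (m_r, n_r)) is (n, k)-strong, then for every subset X ⊆ {1, 2, …, r} we have ∑_{i ∈ X} α_i β_i + ∑_{i ∉ X} (α_i + β_i) H(p_i) ≥ D · k · log n. -/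

import Mathlib

/-- `E` has a bipartite independent set of size `k × k`: a pair of subsets
`S ⊆ V`, `T ⊆ W` of size `k` each with no edge between them. -/
def HasBipIndepSet (n k : ℕ) (E : Finset (Fin n × Fin n)) : Prop :=
  ∃ S T : Finset (Fin n), S.card = k ∧ T.card = k ∧ ∀ s ∈ S, ∀ t ∈ T, (s, t) ∉ E

/-- The sequence of pairs `((ms 0, ns 0), …, (ms (r-1), ns (r-1)))` is
`(n, k)`-strong: there is a bipartite graph `G = (V, W, E)` with `|V| = |W| = n`
that is the union of complete bipartite graphs `G_i = (V_i, W_i, V_i × W_i)` with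
`|V_i| = ms i` and `|W_i| = ns i`, and `G` has no bipartite independent set of size
`k × k`. -/
def IsStrongPairs (n k r : ℕ) (ms ns : Fin r → ℕ) : Prop :=
  ∃ V W : Fin r → Finset (Fin n),
    (∀ i, (V i).card = ms i) ∧ (∀ i, (W i).card = ns i) ∧
    ¬ HasBipIndepSet n k
      ((Finset.univ : Finset (Fin n × Fin n)).filter
        (fun p => ∃ i, p.1 ∈ V i ∧ p.2 ∈ W i))

/-- The binary entropy function `H(p) = -p log p - (1-p) log (1-p)`. -/
noncomputable def binEnt (p : ℝ) : ℝ := -p * Real.log p - (1 - p) * Real.log (1 - p)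

section RandomBits

variable {ι : Type*} [Fintype ι] {q : ι → Bool → ℝ}

/-- Probability of the outcome `x` of independent bits, bit `i` being `b` with probability `q i b`. -/
def bitProb (q : ι → Bool → ℝ) (x : ι → Bool) : ℝ := ∏ i, q i (x i)

/-- Indicator of the event that all bits in `A` equal `b`. -/
def bitsEq (A : Finset ι) (b : Bool) (x : ι → Bool) : ℝ := if ∀ i ∈ A, x i = b then 1 else 0

lemma bitProb_nonneg (hq : ∀ i b, 0 < q i b) (x : ι → Bool) : 0 ≤ bitProb q x :=
  Finset.prod_nonneg fun i _ => (hq i _).le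

lemma bitsEq_nonneg (A : Finset ι) (b : Bool) (x : ι → Bool) : 0 ≤ bitsEq A b x := by
  unfold bitsEq; split_ifs <;> norm_num

variable [DecidableEq ι]

lemma bitsEq_eq_prod (A : Finset ι) (b : Bool) (x : ι → Bool) :
    bitsEq A b x = ∏ i, if i ∈ A ∧ x i ≠ b then (0 : ℝ) else 1 := by
  unfold bitsEq
  split_ifs with h
  · refine (Finset.prod_eq_one fun i _ => if_neg ?_).symm
    exact fun hi => hi.2 (h i hi.1)
  · push Not at h
    obtain ⟨i, hi⟩ := h
    exact (Finset.prod_eq_zero (f := fun i => if i ∈ A ∧ x i ≠ b then (0 : ℝ) else 1)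
      (Finset.mem_univ i) (if_pos hi)).symm

lemma bitsEq_mul_bitsEq (A B : Finset ι) (b : Bool) (x : ι → Bool) :
    bitsEq A b x * bitsEq B b x = bitsEq (A ∪ B) b x := by
  simp only [bitsEq, Finset.mem_union, or_imp, forall_and]
  split_ifs <;> simp_all

lemma sum_prod_bits (f : ι → Bool → ℝ) :
    ∑ x : ι → Bool, ∏ i, f i (x i) = ∏ i, (f i true + f i false) := by
  rw [← Fintype.piFinset_univ, ← Finset.prod_univ_sum]
  simp only [Fintype.sum_bool]

lemma sum_bitProb (hq1 : ∀ i, q i true + q i false = 1) : ∑ x, bitProb q x = 1 := by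
  simp [bitProb, sum_prod_bits, hq1]

lemma sum_bitProb_mul_bitsEq (hq1 : ∀ i, q i true + q i false = 1) (A : Finset ι) (b : Bool) :
    ∑ x, bitProb q x * bitsEq A b x = ∏ i ∈ A, q i b := by
  simp only [bitProb, bitsEq_eq_prod, ← Finset.prod_mul_distrib]
  rw [sum_prod_bits fun i y => q i y * if i ∈ A ∧ y ≠ b then (0 : ℝ) else 1,
    ← Finset.prod_subset A.subset_univ]
  · refine Finset.prod_congr rfl fun i hi => ?_
    cases b <;> simp [hi]
  · intro i _ hi
    simp [hi, hq1]

lemma sum_bitProb_mul_bitsEq_mul_bitsEq_le (hq : ∀ i b, 0 < q i b)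
    (hq1 : ∀ i, q i true + q i false = 1) (A B : Finset ι) :
    ∑ x, bitProb q x * (bitsEq A true x * bitsEq B false x) ≤
      (∏ i ∈ A, q i true) * ∏ i ∈ B, q i false := by
  simp only [bitProb, bitsEq_eq_prod, ← Finset.prod_mul_distrib]
  rw [sum_prod_bits fun i y => q i y * ((if i ∈ A ∧ y ≠ true then (0 : ℝ) else 1) *
    if i ∈ B ∧ y ≠ false then (0 : ℝ) else 1), ← Finset.univ_inter A, ← Finset.univ_inter B,
    ← Finset.prod_ite_mem, ← Finset.prod_ite_mem, ← Finset.prod_mul_distrib]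
  refine Finset.prod_le_prod (fun i _ => ?_) (fun i _ => ?_)
  all_goals
    have h1 := hq i true
    have h2 := hq i false
    have h3 := hq1 i
    by_cases hA : i ∈ A <;> by_cases hB : i ∈ B <;> simp [hA, hB, h3] <;> positivity

/-- Second moment bound: the weights `ω v` equalise the survival probabilities to `P`, and only
pairs whose bit sets meet contribute to the variance. -/
lemma sum_bitProb_mul_sq_le {κ : Type*} (hq : ∀ i b, 0 < q i b)
    (hq1 : ∀ i, q i true + q i false = 1) (b : Bool) (U : Finset κ) (A : κ → Finset ι)
    (ω : κ → ℝ) {P : ℝ} (hω0 : ∀ v ∈ U, 0 ≤ ω v) (hω1 : ∀ v ∈ U, ω v ≤ 1)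
    (hωP : ∀ v ∈ U, ω v * ∏ i ∈ A v, q i b = P) :
    ∑ x, bitProb q x * (∑ v ∈ U, ω v * bitsEq (A v) b x - U.card * P) ^ 2 ≤
      P * ((U ×ˢ U).filter fun z => ¬ Disjoint (A z.1) (A z.2)).card := by
  have hE : ∀ v ∈ U, ∑ x, bitProb q x * (ω v * bitsEq (A v) b x) = P := by
    intro v hv
    rw [← hωP v hv, ← sum_bitProb_mul_bitsEq hq1, Finset.mul_sum]
    exact Finset.sum_congr rfl fun x _ => by ring
  have hexp : ∀ x, bitProb q x * (∑ v ∈ U, ω v * bitsEq (A v) b x - U.card * P) ^ 2 =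
      ∑ z ∈ U ×ˢ U, (ω z.1 * ω z.2 * (bitProb q x * bitsEq (A z.1 ∪ A z.2) b x) -
        P * (bitProb q x * (ω z.1 * bitsEq (A z.1) b x)) -
        P * (bitProb q x * (ω z.2 * bitsEq (A z.2) b x)) + P ^ 2 * bitProb q x) := by
    intro x
    have : ∑ v ∈ U, ω v * bitsEq (A v) b x - U.card * P =
        ∑ v ∈ U, (ω v * bitsEq (A v) b x - P) := by simp [Finset.sum_sub_distrib]
    rw [this, sq, Finset.sum_mul_sum, ← Finset.sum_product', Finset.mul_sum]
    refine Finset.sum_congr rfl fun z _ => ?_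
    rw [← bitsEq_mul_bitsEq]; ring
  simp only [hexp]
  rw [Finset.sum_comm, Finset.card_filter, Nat.cast_sum, Finset.mul_sum]
  refine Finset.sum_le_sum fun z hz => ?_
  obtain ⟨h1, h2⟩ := Finset.mem_product.1 hz
  simp only [Finset.sum_add_distrib, Finset.sum_sub_distrib, ← Finset.mul_sum]
  rw [sum_bitProb_mul_bitsEq hq1, hE _ h1, hE _ h2, sum_bitProb hq1]
  have hpos : ∀ s : Finset ι, 0 < ∏ i ∈ s, q i b := fun s => Finset.prod_pos fun i _ => hq i b
  by_cases hd : Disjoint (A z.1) (A z.2)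
  swap
  · have hle : ∏ i ∈ A z.1 ∪ A z.2, q i b ≤ ∏ i ∈ A z.1, q i b := by
      rw [← Finset.union_sdiff_self_eq_union, Finset.prod_union Finset.disjoint_sdiff]
      refine mul_le_of_le_one_right (hpos _).le
        (Finset.prod_le_one (fun i _ => (hq i b).le) fun i _ => ?_)
      have := hq i true; have := hq i false; have := hq1 i
      cases b <;> linarith
    have h3 : ω z.1 * ω z.2 * ∏ i ∈ A z.1 ∪ A z.2, q i b ≤ P := by
      rw [← hωP _ h1]
      calc _ ≤ ω z.1 * 1 * ∏ i ∈ A z.1, q i b := by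
            have := hω0 _ h1; have := hω1 _ h2; have := hpos (A z.1)
            have := hω0 _ h2; have := hpos (A z.1 ∪ A z.2)
            gcongr
        _ = _ := by ring
    rw [if_pos hd]
    push_cast
    nlinarith [sq_nonneg P]
  · rw [if_neg (not_not.2 hd)]
    rw [Finset.prod_union hd]
    have h4 : ω z.1 * ω z.2 * ((∏ i ∈ A z.1, q i b) * ∏ i ∈ A z.2, q i b) = P * P := by
      
      nth_rewrite 1 [← hωP _ h1]
      rw [← hωP _ h2]
      ring
    rw [h4]; push_cast; nlinarith

/-- Some outcome has both weighted survivor counts close to their means and few weighted surviving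
`R`-pairs. -/
lemma exists_bits_concentrated {κ μ : Type*} (hq : ∀ i b, 0 < q i b)
    (hq1 : ∀ i, q i true + q i false = 1) (U : Finset κ) (U' : Finset μ) (A : κ → Finset ι)
    (B : μ → Finset ι) (f : κ → ℝ) (g : μ → ℝ) {P C M t : ℝ} (hP : 0 < P) (hM : 0 < M) (ht : 0 < t)
    (hf0 : ∀ v ∈ U, 0 ≤ f v) (hf1 : ∀ v ∈ U, f v ≤ 1) (hfP : ∀ v ∈ U, f v * ∏ i ∈ A v, q i true = P)
    (hg0 : ∀ w ∈ U', 0 ≤ g w) (hg1 : ∀ w ∈ U', g w ≤ 1)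
    (hgP : ∀ w ∈ U', g w * ∏ i ∈ B w, q i false = P)
    (hA : (((U ×ˢ U).filter fun z => ¬ Disjoint (A z.1) (A z.2)).card : ℝ) ≤ C)
    (hB : (((U' ×ˢ U').filter fun z => ¬ Disjoint (B z.1) (B z.2)).card : ℝ) ≤ C)
    (hC : 4 * (P * C) ≤ t ^ 2) (E : Finset (κ × μ)) (hE : E ⊆ U ×ˢ U') (hEM : (E.card : ℝ) ≤ M) :
    ∃ x : ι → Bool, U.card * P - t ≤ ∑ v ∈ U, f v * bitsEq (A v) true x ∧
      U'.card * P - t ≤ ∑ w ∈ U', g w * bitsEq (B w) false x ∧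
      ∑ z ∈ E, (f z.1 * bitsEq (A z.1) true x) * (g z.2 * bitsEq (B z.2) false x) ≤
        4 * P ^ 2 * M := by
  set Z : (ι → Bool) → ℝ := fun x => ∑ v ∈ U, f v * bitsEq (A v) true x - U.card * P with hZ
  set Z' : (ι → Bool) → ℝ := fun x => ∑ w ∈ U', g w * bitsEq (B w) false x - U'.card * P with hZ'
  set N : (ι → Bool) → ℝ := fun x =>
    ∑ z ∈ E, (f z.1 * bitsEq (A z.1) true x) * (g z.2 * bitsEq (B z.2) false x) with hN
  have h1 : ∑ x, bitProb q x * Z x ^ 2 ≤ P * C :=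
    (sum_bitProb_mul_sq_le hq hq1 true U A f hf0 hf1 hfP).trans (by gcongr)
  have h2 : ∑ x, bitProb q x * Z' x ^ 2 ≤ P * C :=
    (sum_bitProb_mul_sq_le hq hq1 false U' B g hg0 hg1 hgP).trans (by gcongr)
  have h3 : ∑ x, bitProb q x * N x ≤ P ^ 2 * M := by
    calc ∑ x, bitProb q x * N x = ∑ z ∈ E, f z.1 * g z.2 *
          ∑ x, bitProb q x * (bitsEq (A z.1) true x * bitsEq (B z.2) false x) := by
          simp only [hN, Finset.mul_sum]
          rw [Finset.sum_comm]
          exact Finset.sum_congr rfl fun z _ => Finset.sum_congr rfl fun x _ => by ring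
      _ ≤ ∑ z ∈ E, P ^ 2 := by
          refine Finset.sum_le_sum fun z hz => ?_
          obtain ⟨hz1, hz2⟩ := Finset.mem_product.1 (hE hz)
          refine (mul_le_mul_of_nonneg_left
            (sum_bitProb_mul_bitsEq_mul_bitsEq_le hq hq1 (A z.1) (B z.2))
            (mul_nonneg (hf0 _ hz1) (hg0 _ hz2))).trans_eq ?_
          rw [sq]
          nth_rewrite 1 [← hfP _ hz1]
          rw [← hgP _ hz2]
          ring
      _ ≤ P ^ 2 * M := by
          rw [Finset.sum_const, nsmul_eq_mul, mul_comm]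
          gcongr
  have hN0 : ∀ x, 0 ≤ N x := fun x => Finset.sum_nonneg fun z hz => by
    obtain ⟨hz1, hz2⟩ := Finset.mem_product.1 (hE hz)
    exact mul_nonneg (mul_nonneg (hf0 _ hz1) (bitsEq_nonneg _ _ _))
      (mul_nonneg (hg0 _ hz2) (bitsEq_nonneg _ _ _))
  have hsum : ∑ x, bitProb q x * (Z x ^ 2 / t ^ 2 + Z' x ^ 2 / t ^ 2 + N x / (4 * P ^ 2 * M)) <
      ∑ x, bitProb q x * 1 := by
    have e : ∀ x, bitProb q x * (Z x ^ 2 / t ^ 2 + Z' x ^ 2 / t ^ 2 + N x / (4 * P ^ 2 * M)) =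
        bitProb q x * Z x ^ 2 / t ^ 2 + bitProb q x * Z' x ^ 2 / t ^ 2 +
          bitProb q x * N x / (4 * P ^ 2 * M) := fun x => by ring
    simp only [e, mul_one, Finset.sum_add_distrib, ← Finset.sum_div]
    rw [sum_bitProb hq1]
    have i1 : (∑ x, bitProb q x * Z x ^ 2) / t ^ 2 ≤ 1 / 4 := by
      rw [div_le_iff₀ (by positivity)]; linarith
    have i2 : (∑ x, bitProb q x * Z' x ^ 2) / t ^ 2 ≤ 1 / 4 := by
      rw [div_le_iff₀ (by positivity)]; linarith
    have i3 : (∑ x, bitProb q x * N x) / (4 * P ^ 2 * M) ≤ 1 / 4 := by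
      rw [div_le_iff₀ (by positivity)]; linarith
    linarith
  obtain ⟨x, -, hx⟩ := Finset.exists_lt_of_sum_lt hsum
  have hx1 := lt_of_mul_lt_mul_left hx (bitProb_nonneg hq x)
  have p1 : 0 ≤ Z x ^ 2 / t ^ 2 := by positivity
  have p2 : 0 ≤ Z' x ^ 2 / t ^ 2 := by positivity
  have p3 : 0 ≤ N x / (4 * P ^ 2 * M) := div_nonneg (hN0 x) (by positivity)
  have j1 : Z x ^ 2 / t ^ 2 < 1 := by linarith
  have j2 : Z' x ^ 2 / t ^ 2 < 1 := by linarith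
  have j3 : N x / (4 * P ^ 2 * M) < 1 := by linarith
  rw [div_lt_one (by positivity)] at j1 j2 j3
  have k1 := (abs_lt_of_sq_lt_sq' j1 ht.le).1
  have k2 := (abs_lt_of_sq_lt_sq' j2 ht.le).1
  refine ⟨x, ?_, ?_, j3.le⟩
  · simp only [hZ] at k1; linarith
  · simp only [hZ'] at k2; linarith

end RandomBits

/-- Greedy selection in a relation of small weighted degree: `j` vertices of `S` whose common
non-neighbourhood in `T` is still heavy. -/
lemma exists_greedy_independent {κ μ : Type*} [DecidableEq κ] [DecidableEq μ]
    (R : κ → μ → Prop) [∀ v w, Decidable (R v w)] (S : Finset κ) (T : Finset μ)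
    (f : κ → ℝ) (g : μ → ℝ) (hf : ∀ v ∈ S, 0 < f v) (hf1 : ∀ v ∈ S, f v ≤ 1)
    (hg : ∀ w ∈ T, 0 ≤ g w) {c δ : ℝ} (hc : 0 ≤ c) (hδ0 : 0 < δ) (hδ1 : δ ≤ 1)
    (hdeg : ∀ w ∈ T, ∑ v ∈ S.filter (R · w), f v ≤ c) (j : ℕ) (hj : j + c / δ ≤ ∑ v ∈ S, f v) :
    ∃ K ⊆ S, ∃ T' ⊆ T, K.card = j ∧ (∀ v ∈ K, ∀ w ∈ T', ¬ R v w) ∧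
      (1 - δ) ^ j * ∑ w ∈ T, g w ≤ ∑ w ∈ T', g w := by
  induction j with
  | zero => exact ⟨∅, by simp, T, subset_rfl, by simp⟩
  | succ j ih =>
    push_cast at hj
    obtain ⟨K, hK, T', hT', hcard, hR, hw⟩ := ih (by linarith)
    have hKw : ∑ v ∈ K, f v ≤ j := by
      rw [← hcard]
      simpa using Finset.sum_le_sum fun v hv => hf1 v (hK hv)
    have hrest := Finset.sum_sdiff hK (f := f)
    have hcδ : 0 ≤ c / δ := by positivity
    have hne : (S \ K).Nonempty := by
      rw [Finset.nonempty_iff_ne_empty]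
      intro h
      rw [h, Finset.sum_empty] at hrest
      linarith
    have hT0 : 0 ≤ ∑ w ∈ T', g w := Finset.sum_nonneg fun w hw => hg w (hT' hw)
    have hdouble : ∑ v ∈ S \ K, f v * ∑ w ∈ T'.filter (R v ·), g w ≤
        ∑ v ∈ S \ K, f v * (δ * ∑ w ∈ T', g w) := by
      calc ∑ v ∈ S \ K, f v * ∑ w ∈ T'.filter (R v ·), g w
          = ∑ w ∈ T', g w * ∑ v ∈ (S \ K).filter (R · w), f v := by
            simp only [Finset.sum_filter, Finset.mul_sum]
            rw [Finset.sum_comm]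
            refine Finset.sum_congr rfl fun w _ => Finset.sum_congr rfl fun v _ => ?_
            split_ifs <;> ring
        _ ≤ ∑ w ∈ T', g w * c := by
            refine Finset.sum_le_sum fun w hw => mul_le_mul_of_nonneg_left ?_ (hg w (hT' hw))
            refine le_trans (Finset.sum_le_sum_of_subset_of_nonneg
              (Finset.filter_subset_filter _ Finset.sdiff_subset) fun v hv _ => ?_)
              (hdeg w (hT' hw))
            exact (hf v (Finset.mem_filter.1 hv).1).le
        _ = (c / δ) * (δ * ∑ w ∈ T', g w) := by rw [← Finset.sum_mul]; field_simp
        _ ≤ (∑ v ∈ S \ K, f v) * (δ * ∑ w ∈ T', g w) := by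
            gcongr; linarith
        _ = _ := by rw [Finset.sum_mul]
    obtain ⟨v, hv, hle⟩ := Finset.exists_le_of_sum_le hne hdouble
    obtain ⟨hvS, hvK⟩ := Finset.mem_sdiff.1 hv
    have hdv := le_of_mul_le_mul_left hle (hf v hvS)
    refine ⟨insert v K, Finset.insert_subset hvS hK, T'.filter (¬ R v ·),
      (Finset.filter_subset _ _).trans hT', by rw [Finset.card_insert_of_notMem hvK, hcard], ?_, ?_⟩
    · intro u hu w hw
      obtain ⟨hwT, hwR⟩ := Finset.mem_filter.1 hw
      rcases Finset.mem_insert.1 hu with rfl | hu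
      · exact hwR
      · exact hR u hu w hwT
    · have hsplit := Finset.sum_filter_add_sum_filter_not T' (R v ·) g
      rw [pow_succ]
      have := mul_le_mul_of_nonneg_left hw (sub_nonneg.2 hδ1)
      linarith

/-- Markov's inequality for counting. -/
lemma half_le_card_filter_le {κ : Type*} [Fintype κ] (f : κ → ℝ) (hf : ∀ v, 0 ≤ f v) {ℓ : ℝ}
    (hℓ : 0 < ℓ) (h : ∑ v, f v ≤ Fintype.card κ * ℓ) :
    (Fintype.card κ : ℝ) / 2 ≤ ((Finset.univ.filter fun v => f v ≤ 2 * ℓ).card : ℝ) := by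
  have h1 := Finset.card_filter_add_card_filter_not (s := Finset.univ) (fun v => f v ≤ 2 * ℓ)
  have h2 : ((Finset.univ.filter fun v => ¬ f v ≤ 2 * ℓ).card : ℝ) * (2 * ℓ) ≤ ∑ v, f v := by
    rw [← nsmul_eq_mul]
    refine (Finset.card_nsmul_le_sum _ _ _ fun v hv => ?_).trans
      (Finset.sum_le_sum_of_subset_of_nonneg (Finset.filter_subset _ _) fun v _ _ => hf v)
    exact (not_le.1 (Finset.mem_filter.1 hv).2).le
  have h3 : (((Finset.univ.filter fun v => f v ≤ 2 * ℓ).card : ℝ)) +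
      ((Finset.univ.filter fun v => ¬ f v ≤ 2 * ℓ).card : ℝ) = Fintype.card κ := by
    exact_mod_cast h1
  have h4 : ((Finset.univ.filter fun v => ¬ f v ≤ 2 * ℓ).card : ℝ) * 2 ≤ Fintype.card κ :=
    le_of_mul_le_mul_right (by linarith) hℓ
  linarith

lemma card_filter_not_disjoint_le {ι κ : Type*} [Fintype κ] [DecidableEq κ] [DecidableEq ι]
    (Y : Finset ι) (V : ι → Finset κ) (U : Finset κ) :
    ((U ×ˢ U).filter fun z => ¬ Disjoint (Y.filter (z.1 ∈ V ·)) (Y.filter (z.2 ∈ V ·))).card ≤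
      ∑ i ∈ Y, (V i).card ^ 2 := by
  calc _ ≤ (Y.biUnion fun i => V i ×ˢ V i).card := by
        refine Finset.card_le_card fun z hz => ?_
        obtain ⟨i, h1, h2⟩ := Finset.not_disjoint_iff.1 (Finset.mem_filter.1 hz).2
        simp only [Finset.mem_filter] at h1 h2
        exact Finset.mem_biUnion.2 ⟨i, h1.1, Finset.mem_product.2 ⟨h1.2, h2.2⟩⟩
    _ ≤ ∑ i ∈ Y, (V i ×ˢ V i).card := Finset.card_biUnion_le
    _ = _ := by simp [sq]

lemma sum_sum_filter_mem {ι κ : Type*} [Fintype κ] [DecidableEq κ] (Y : Finset ι)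
    (V : ι → Finset κ) (a : ι → ℝ) :
    ∑ v, ∑ i ∈ Y.filter (v ∈ V ·), a i = ∑ i ∈ Y, (V i).card * a i := by
  simp only [Finset.sum_filter]
  rw [Finset.sum_comm]
  exact Finset.sum_congr rfl fun i _ => by simp

/-- Vertices lying in few of the sets `V i` (measured by `-log (p i)`) form at least half of all
vertices, and can be weighted so that their survival probabilities all equal `exp (-2 * ℓ)`. -/
lemma exists_equalizing_weights {ι κ : Type*} [Fintype κ] [DecidableEq κ]
    (Y : Finset ι) (V : ι → Finset κ) (p : ι → ℝ) (hp : ∀ i, 0 < p i) (hp1 : ∀ i, p i ≤ 1) {ℓ : ℝ}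
    (hℓ : 0 < ℓ) (h : ∑ i ∈ Y, (V i).card * -Real.log (p i) ≤ Fintype.card κ * ℓ) :
    ∃ (U : Finset κ) (f : κ → ℝ), (Fintype.card κ : ℝ) / 2 ≤ U.card ∧ (∀ v, 0 < f v) ∧
      (∀ v ∈ U, f v ≤ 1) ∧
      ∀ v, f v * ∏ i ∈ Y.filter (v ∈ V ·), p i = Real.exp (-2 * ℓ) := by
  have hpos : ∀ v, 0 < ∏ i ∈ Y.filter (v ∈ V ·), p i := fun v => Finset.prod_pos fun i _ => hp i
  refine ⟨_, fun v => Real.exp (-2 * ℓ) / ∏ i ∈ Y.filter (v ∈ V ·), p i,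
    half_le_card_filter_le (fun v => ∑ i ∈ Y.filter (v ∈ V ·), -Real.log (p i))
      (fun v => Finset.sum_nonneg fun i _ =>
        neg_nonneg.2 (Real.log_nonpos (hp i).le (hp1 i))) hℓ ?_,
    fun v => div_pos (Real.exp_pos _) (hpos v), fun v hv => ?_,
    fun v => div_mul_cancel₀ _ (hpos v).ne'⟩
  · rwa [sum_sum_filter_mem]
  · have hv := (Finset.mem_filter.1 hv).2
    rw [div_le_one (hpos v), ← Real.le_log_iff_exp_le (hpos v), Real.log_prod fun i _ => (hp i).ne']
    rw [Finset.sum_neg_distrib] at hv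
    linarith

/-- A union of complete bipartite graphs that is sparse on `X` and has small entropy cost off `X`
has a `k × k` bipartite independent set. -/
theorem exists_bipIndep_of_sparse {ι κ μ : Type*} [Fintype ι] [DecidableEq ι] [Fintype κ]
    [DecidableEq κ] [Fintype μ] [DecidableEq μ] {n k : ℕ} (hn : 0 < n) (hκ : Fintype.card κ = n)
    (hμ : Fintype.card μ = n) (V : ι → Finset κ) (W : ι → Finset μ) (X : Finset ι)
    (q : ι → Bool → ℝ) (hq : ∀ i b, 0 < q i b) (hq1 : ∀ i, q i true + q i false = 1)
    {ℓ C M : ℝ} (hℓ : 0 < ℓ) (hM : 0 < M)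
    (hLV : ∑ i ∈ Xᶜ, (V i).card * -Real.log (q i true) ≤ n * ℓ)
    (hLW : ∑ i ∈ Xᶜ, (W i).card * -Real.log (q i false) ≤ n * ℓ)
    (hCV : ∑ i ∈ Xᶜ, ((V i).card : ℝ) ^ 2 ≤ C) (hCW : ∑ i ∈ Xᶜ, ((W i).card : ℝ) ^ 2 ≤ C)
    (hVW : ∑ i ∈ X, ((V i).card : ℝ) * (W i).card ≤ M)
    (hC : 64 * C ≤ n ^ 2 * Real.exp (-2 * ℓ)) (hMn : 256 * M / n ^ 2 ≤ 1)
    (hk : (k : ℝ) ≤ n * Real.exp (-2 * ℓ) / 8)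
    (hkM : (k : ℝ) ≤ (1 - 256 * M / n ^ 2) ^ k * (n * Real.exp (-2 * ℓ) / 8)) :
    ∃ (S : Finset κ) (T : Finset μ), S.card = k ∧ T.card = k ∧
      ∀ s ∈ S, ∀ t ∈ T, ¬ ∃ i, s ∈ V i ∧ t ∈ W i := by
  have hn' : (0 : ℝ) < n := by exact_mod_cast hn
  have hqle : ∀ i b, q i b ≤ 1 := fun i b => by
    have := hq i true; have := hq i false; have := hq1 i
    cases b <;> linarith
  obtain ⟨U, f, hU, hf0, hf1, hfP⟩ := exists_equalizing_weights Xᶜ V (q · true) (hq · true)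
    (hqle · true) hℓ (by rwa [hκ])
  obtain ⟨U', g, hU', hg0, hg1, hgP⟩ := exists_equalizing_weights Xᶜ W (q · false) (hq · false)
    (hqle · false) hℓ (by rwa [hμ])
  rw [hκ] at hU
  rw [hμ] at hU'
  set P := Real.exp (-2 * ℓ) with hPdef
  have hP : 0 < P := Real.exp_pos _
  have hEM : (((U ×ˢ U').filter fun z => ∃ i ∈ X, z.1 ∈ V i ∧ z.2 ∈ W i).card : ℝ) ≤ M := by
    refine le_trans ?_ hVW
    have : ((U ×ˢ U').filter fun z => ∃ i ∈ X, z.1 ∈ V i ∧ z.2 ∈ W i).card ≤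
        ∑ i ∈ X, (V i).card * (W i).card := by
      refine (Finset.card_le_card (t := X.biUnion fun i => V i ×ˢ W i) fun z hz => ?_).trans
        (Finset.card_biUnion_le.trans_eq (by simp))
      obtain ⟨i, hi, h⟩ := (Finset.mem_filter.1 hz).2
      exact Finset.mem_biUnion.2 ⟨i, hi, Finset.mem_product.2 h⟩
    exact_mod_cast this
  obtain ⟨x, hx1, hx2, hx3⟩ := exists_bits_concentrated hq hq1 U U'
    (fun v => Xᶜ.filter (v ∈ V ·)) (fun w => Xᶜ.filter (w ∈ W ·)) f g (P := P) (C := C) (M := M)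
    (t := n * P / 4) hP hM (by positivity) (fun v _ => (hf0 v).le) hf1 (fun v _ => hfP v)
    (fun w _ => (hg0 w).le) hg1 (fun w _ => hgP w)
    (le_trans (by exact_mod_cast card_filter_not_disjoint_le Xᶜ V U) hCV)
    (le_trans (by exact_mod_cast card_filter_not_disjoint_le Xᶜ W U') hCW)
    (by nlinarith [mul_le_mul_of_nonneg_left hC hP.le]) _ (Finset.filter_subset _ _) hEM
  set S := U.filter fun v => ∀ i ∈ Xᶜ.filter (v ∈ V ·), x i = true with hS
  set T := U'.filter fun w => ∀ i ∈ Xᶜ.filter (w ∈ W ·), x i = false with hT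
  have hSw : n * P / 4 ≤ ∑ v ∈ S, f v := by
    simp only [bitsEq, mul_ite, mul_one, mul_zero] at hx1
    rw [hS, Finset.sum_filter]
    nlinarith
  have hTw : n * P / 4 ≤ ∑ w ∈ T, g w := by
    simp only [bitsEq, mul_ite, mul_one, mul_zero] at hx2
    rw [hT, Finset.sum_filter]
    nlinarith
  set R : κ → μ → Prop := fun v w => ∃ i ∈ X, v ∈ V i ∧ w ∈ W i with hR
  set d : μ → ℝ := fun w => ∑ v ∈ S.filter (R · w), f v with hd
  have hd0 : ∀ w, 0 ≤ d w := fun w => Finset.sum_nonneg fun v _ => (hf0 v).le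
  have hdeg : ∑ w ∈ T, g w * d w ≤ 4 * P ^ 2 * M := by
    refine le_of_eq_of_le ?_ hx3
    simp only [hd, hS, hT, bitsEq, Finset.sum_filter, Finset.sum_product_right, Finset.mul_sum]
    refine Finset.sum_congr rfl fun w _ => ?_
    split_ifs with h
    · refine Finset.sum_congr rfl fun v _ => ?_
      split_ifs <;> simp_all [mul_comm]
    · exact (Finset.sum_eq_zero fun v _ => by simp).symm
  set c : ℝ := 32 * M * P / n with hc
  have hc0 : 0 < c := by positivity
  have hTlow : n * P / 8 ≤ ∑ w ∈ T.filter (d · ≤ c), g w := by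
    have hsplit := Finset.sum_filter_add_sum_filter_not T (d · ≤ c) g
    have hbad : (∑ w ∈ T.filter (¬ d · ≤ c), g w) * c ≤ n * P / 8 * c := by
      calc _ ≤ ∑ w ∈ T.filter (¬ d · ≤ c), g w * d w := by
            rw [Finset.sum_mul]
            refine Finset.sum_le_sum fun w hw => mul_le_mul_of_nonneg_left ?_ (hg0 w).le
            exact (not_le.1 (Finset.mem_filter.1 hw).2).le
        _ ≤ ∑ w ∈ T, g w * d w := Finset.sum_le_sum_of_subset_of_nonneg (Finset.filter_subset _ _)
            fun w _ _ => mul_nonneg (hg0 w).le (hd0 w)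
        _ ≤ 4 * P ^ 2 * M := hdeg
        _ = _ := by rw [hc]; field_simp; norm_num
    have := le_of_mul_le_mul_right hbad hc0
    linarith
  have hcδ : c / (256 * M / n ^ 2) = n * P / 8 := by rw [hc]; field_simp; norm_num
  obtain ⟨K, hK, T', hT', hKcard, hKT, hw⟩ := exists_greedy_independent R S (T.filter (d · ≤ c)) f g
    (fun v _ => hf0 v) (fun v hv => hf1 v (Finset.mem_filter.1 hv).1) (fun w _ => (hg0 w).le) hc0.le
    (δ := 256 * M / n ^ 2) (by positivity) hMn (fun w hw => (Finset.mem_filter.1 hw).2) k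
    (by rw [hcδ]; linarith)
  have hT'card : k ≤ T'.card := by
    have h1 : ∑ w ∈ T', g w ≤ T'.card := by
      simpa using Finset.sum_le_sum fun w (hw : w ∈ T') =>
        hg1 w (Finset.mem_filter.1 (Finset.mem_filter.1 (hT' hw)).1).1
    have h2 : (0 : ℝ) ≤ (1 - 256 * M / n ^ 2) ^ k := pow_nonneg (sub_nonneg.2 hMn) _
    have h3 := mul_le_mul_of_nonneg_left hTlow h2
    exact_mod_cast (hkM.trans h3).trans (hw.trans h1)
  obtain ⟨T'', hT'', hT''card⟩ := Finset.exists_subset_card_eq hT'card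
  refine ⟨K, T'', hKcard, hT''card, ?_⟩
  rintro s hs t ht ⟨i, hsi, hti⟩
  by_cases hi : i ∈ X
  · exact hKT s hs t (hT'' ht) ⟨i, hi, hsi, hti⟩
  · have h1 := (Finset.mem_filter.1 (hK hs)).2 i (by simp [hi, hsi])
    have h2 := (Finset.mem_filter.1 (Finset.mem_filter.1 (hT' (hT'' ht))).1).2 i (by simp [hi, hti])
    simp [h1] at h2

lemma add_mul_binEnt {a b : ℝ} (ha : 0 < a) (hb : 0 < b) :
    (a + b) * binEnt (a / (a + b)) =
      a * -Real.log (a / (a + b)) + b * -Real.log (b / (a + b)) := by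
  have h : 1 - a / (a + b) = b / (a + b) := by field_simp; ring
  rw [binEnt, h]
  field_simp
  ring

lemma neg_log_div_add_nonneg {a b : ℝ} (ha : 0 < a) (hb : 0 < b) :
    0 ≤ -Real.log (a / (a + b)) :=
  neg_nonneg.2 (Real.log_nonpos (by positivity) ((div_le_one (by positivity)).2 (by linarith)))

lemma sq_le_entropy_cost {a b A : ℝ} (hA : 0 < A) (ha : 0 < a) (haA : a ≤ A) (hb : A⁻¹ ≤ b)
    (hbA : b ≤ A) : a ^ 2 ≤ 2 * A ^ 3 * (b * -Real.log (b / (a + b))) := by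
  have hb0 : 0 < b := (inv_pos.2 hA).trans_le hb
  have h1 : a / (a + b) ≤ -Real.log (b / (a + b)) := by
    have := Real.log_le_sub_one_of_pos (x := b / (a + b)) (by positivity)
    have h : a / (a + b) = 1 - b / (a + b) := by field_simp; ring
    linarith
  have hbA1 : 1 ≤ A * b := by
    rw [inv_le_iff_one_le_mul₀ hA] at hb
    linarith
  calc a ^ 2 ≤ 2 * A ^ 3 * (b * (a / (a + b))) := by
        rw [show 2 * A ^ 3 * (b * (a / (a + b))) = 2 * A ^ 3 * b * a / (a + b) by ring,
          le_div_iff₀ (by positivity)]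
        have h2 : a * (a + b) ≤ A * (2 * A) := by gcongr; linarith
        calc a ^ 2 * (a + b) = a * (a + b) * 1 * a := by ring
          _ ≤ A * (2 * A) * (A * b) * a := by gcongr
          _ = 2 * A ^ 3 * b * a := by ring
    _ ≤ _ := by gcongr

lemma exp_neg_two_mul_le_one_sub {δ : ℝ} (h0 : 0 ≤ δ) (h : δ ≤ 1 / 2) :
    Real.exp (-2 * δ) ≤ 1 - δ := by
  have h1 : 0 < 1 - δ := by linarith
  rw [← Real.le_log_iff_exp_le h1]
  refine le_trans ?_ (Real.one_sub_inv_le_log_of_pos h1)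
  have : (1 - δ)⁻¹ ≤ 1 + 2 * δ := by
    rw [inv_le_iff_one_le_mul₀ h1]
    nlinarith
  linarith

/-- The main inequality, with `a = n ^ (1 / 100)`. -/
theorem strong_entropy_bound {n k r : ℕ} {a : ℝ} (ha : 8 ≤ a) (hna : (n : ℝ) = a ^ 100)
    (hk1 : a ^ 10 ≤ k) (hk2 : (k : ℝ) ≤ a ^ 90) (α β : Fin r → ℝ) (ms ns : Fin r → ℕ)
    (hα : ∀ i, a⁻¹ ≤ α i ∧ α i ≤ a) (hβ : ∀ i, a⁻¹ ≤ β i ∧ β i ≤ a)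
    (hms : ∀ i, (ms i : ℝ) = α i * ((n : ℝ) / k)) (hns : ∀ i, (ns i : ℝ) = β i * ((n : ℝ) / k))
    (hstrong : IsStrongPairs n k r ms ns) (X : Finset (Fin r)) :
    1 / 10000 * (k : ℝ) * Real.log n ≤ ∑ i ∈ X, α i * β i +
      ∑ i ∈ Xᶜ, (α i + β i) * binEnt (α i / (α i + β i)) := by
  by_contra! hlt
  have ha0 : 0 < a := by linarith
  have hα0 : ∀ i, 0 < α i := fun i => (inv_pos.2 ha0).trans_le (hα i).1
  have hβ0 : ∀ i, 0 < β i := fun i => (inv_pos.2 ha0).trans_le (hβ i).1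
  have hn : (0 : ℝ) < n := by rw [hna]; positivity
  have hk : (0 : ℝ) < k := lt_of_lt_of_le (by positivity) hk1
  have hlog : Real.log n = 100 * Real.log a := by rw [hna, Real.log_pow]; norm_num
  set t := Real.log a with ht
  have ht0 : 0 < t := Real.log_pos (by linarith)
  have hta : t ≤ a := by linarith [Real.log_le_sub_one_of_pos ha0]
  have hexp : ∀ m : ℕ, Real.exp (-(m * t)) = (a ^ m)⁻¹ := fun m => by
    rw [Real.exp_neg, Real.exp_nat_mul, Real.exp_log ha0]
  have hpow : ∀ i j : ℕ, i + 1 ≤ j → 8 * a ^ i ≤ a ^ j := fun i j hij => by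
    calc 8 * a ^ i ≤ a * a ^ i := by gcongr
      _ = a ^ (i + 1) := by ring
      _ ≤ a ^ j := pow_le_pow_right₀ (by linarith) hij
  rw [hlog] at hlt
  set Q : Fin r → ℝ := fun i => α i * -Real.log (α i / (α i + β i)) with hQ
  set Q' : Fin r → ℝ := fun i => β i * -Real.log (β i / (α i + β i)) with hQ'
  have hQ0 : ∀ i, 0 ≤ Q i := fun i =>
    mul_nonneg (hα0 i).le (neg_log_div_add_nonneg (hα0 i) (hβ0 i))
  have hQ0' : ∀ i, 0 ≤ Q' i := fun i => mul_nonneg (hβ0 i).le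
    (by simpa only [add_comm] using neg_log_div_add_nonneg (hβ0 i) (hα0 i))
  have hsplit : ∑ i ∈ Xᶜ, (α i + β i) * binEnt (α i / (α i + β i)) =
      ∑ i ∈ Xᶜ, Q i + ∑ i ∈ Xᶜ, Q' i := by
    rw [← Finset.sum_add_distrib]
    exact Finset.sum_congr rfl fun i _ => add_mul_binEnt (hα0 i) (hβ0 i)
  rw [hsplit] at hlt
  have hs1 : 0 ≤ ∑ i ∈ X, α i * β i :=
    Finset.sum_nonneg fun i _ => mul_nonneg (hα0 i).le (hβ0 i).le
  have hs2 : 0 ≤ ∑ i ∈ Xᶜ, Q i := Finset.sum_nonneg fun i _ => hQ0 i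
  have hs3 : 0 ≤ ∑ i ∈ Xᶜ, Q' i := Finset.sum_nonneg fun i _ => hQ0' i
  obtain ⟨V, W, hV, hW, hind⟩ := hstrong
  have hVc : ∀ i, ((V i).card : ℝ) = α i * ((n : ℝ) / k) := fun i => by rw [hV, hms]
  have hWc : ∀ i, ((W i).card : ℝ) = β i * ((n : ℝ) / k) := fun i => by rw [hW, hns]
  have hP : (a ^ 1)⁻¹ ≤ Real.exp (-2 * (t / 100)) := by
    rw [← hexp]; apply Real.exp_le_exp.2; push_cast; linarith
  have h90 : 8 * a ^ 90 ≤ a ^ 94 := hpow 90 94 (by norm_num)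
  have hδ : 256 * (n ^ 2 * (t / 100) / k) / (n : ℝ) ^ 2 = 256 * (t / 100) / k := by field_simp
  have hδ2 : 256 * (t / 100) / k ≤ 1 / 2 := by
    rw [div_le_iff₀ hk]
    have h1 : 8 * a ^ 1 ≤ a ^ 10 := hpow 1 10 (by norm_num)
    linarith
  refine hind ?_
  suffices h : ∃ S T : Finset (Fin n), S.card = k ∧ T.card = k ∧
      ∀ s ∈ S, ∀ t ∈ T, ¬ ∃ i, s ∈ V i ∧ t ∈ W i by
    obtain ⟨S, T, hS, hT, hST⟩ := h
    exact ⟨S, T, hS, hT, fun s hs t ht h => hST s hs t ht (Finset.mem_filter.1 h).2⟩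
  refine exists_bipIndep_of_sparse (k := k) (by exact_mod_cast hn)
    (Fintype.card_fin n) (Fintype.card_fin n) V W X
    (fun i b => if b then α i / (α i + β i) else β i / (α i + β i)) (fun i b => by
      have := hα0 i; have := hβ0 i
      cases b <;> simp <;> positivity) (fun i => by
      have := hα0 i; have := hβ0 i
      simp; field_simp) (ℓ := t / 100) (C := (n / k) ^ 2 * (2 * a ^ 3 * (k * (t / 100))))
    (M := n ^ 2 * (t / 100) / k) (by positivity) (by positivity) ?_ ?_ ?_ ?_ ?_ ?_ ?_ ?_ ?_
  · calc _ = (n / k : ℝ) * ∑ i ∈ Xᶜ, Q i := by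
          rw [Finset.mul_sum]
          refine Finset.sum_congr rfl fun i _ => ?_
          rw [hVc]; simp only [hQ, if_true]; ring
      _ ≤ (n / k : ℝ) * (k * (t / 100)) := by gcongr; linarith
      _ = _ := by field_simp
  · calc _ = (n / k : ℝ) * ∑ i ∈ Xᶜ, Q' i := by
          rw [Finset.mul_sum]
          refine Finset.sum_congr rfl fun i _ => ?_
          rw [hWc]; simp only [hQ', Bool.false_eq_true, if_false]; ring
      _ ≤ (n / k : ℝ) * (k * (t / 100)) := by gcongr; linarith
      _ = _ := by field_simp
  · calc _ = (n / k : ℝ) ^ 2 * ∑ i ∈ Xᶜ, α i ^ 2 := by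
          rw [Finset.mul_sum]
          exact Finset.sum_congr rfl fun i _ => by rw [hVc]; ring
      _ ≤ (n / k : ℝ) ^ 2 * ∑ i ∈ Xᶜ, 2 * a ^ 3 * Q' i := by
          gcongr with i
          exact sq_le_entropy_cost ha0 (hα0 i) (hα i).2 (hβ i).1 (hβ i).2
      _ ≤ _ := by rw [← Finset.mul_sum]; gcongr; linarith
  · calc _ = (n / k : ℝ) ^ 2 * ∑ i ∈ Xᶜ, β i ^ 2 := by
          rw [Finset.mul_sum]
          exact Finset.sum_congr rfl fun i _ => by rw [hWc]; ring
      _ ≤ (n / k : ℝ) ^ 2 * ∑ i ∈ Xᶜ, 2 * a ^ 3 * Q i := by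
          gcongr with i
          simpa only [hQ, add_comm (α i)] using
            sq_le_entropy_cost ha0 (hβ0 i) (hβ i).2 (hα i).1 (hα i).2
      _ ≤ _ := by rw [← Finset.mul_sum]; gcongr; linarith
  · calc _ = (n / k : ℝ) ^ 2 * ∑ i ∈ X, α i * β i := by
          rw [Finset.mul_sum]
          exact Finset.sum_congr rfl fun i _ => by rw [hVc, hWc]; ring
      _ ≤ (n / k : ℝ) ^ 2 * (k * (t / 100)) := by gcongr; linarith
      _ = _ := by field_simp
  · calc _ = (n : ℝ) ^ 2 * (128 * a ^ 3 * (t / 100) / k) := by field_simp; ring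
      _ ≤ _ := by
        gcongr
        refine le_trans ?_ hP
        rw [div_le_iff₀ hk, ← div_eq_inv_mul, le_div_iff₀ (by positivity)]
        have h1 : 8 * a ^ 5 ≤ a ^ 10 := hpow 5 10 (by norm_num)
        have h2 : 128 * a ^ 3 * (t / 100) * a ^ 1 ≤ 128 * a ^ 3 * (a / 100) * a ^ 1 := by gcongr
        have h3 : 0 ≤ a ^ 5 := by positivity
        nlinarith
  · rw [hδ]; linarith
  · have h1 : a ^ 100 * (a ^ 1)⁻¹ ≤ n * Real.exp (-2 * (t / 100)) := by rw [hna]; gcongr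
    have h2 : a ^ 100 * (a ^ 1)⁻¹ = a ^ 99 := by field_simp
    have h3 : 8 * a ^ 90 ≤ a ^ 99 := hpow 90 99 (by norm_num)
    linarith
  · rw [hδ]
    have h1 : Real.exp (-2 * (256 * (t / 100) / k)) ^ k ≤ (1 - 256 * (t / 100) / k) ^ k := by
      gcongr
      exact exp_neg_two_mul_le_one_sub (by positivity) hδ2
    have h2 : (a ^ 6)⁻¹ * a ^ 100 / 8 ≤ (1 - 256 * (t / 100) / k) ^ k *
        (n * Real.exp (-2 * (t / 100)) / 8) := by
      calc (a ^ 6)⁻¹ * a ^ 100 / 8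
          ≤ Real.exp (-514 * (t / 100)) * a ^ 100 / 8 := by
            rw [← hexp]
            gcongr
            push_cast
            linarith
        _ = Real.exp (-2 * (256 * (t / 100) / k)) ^ k *
              (n * Real.exp (-2 * (t / 100)) / 8) := by
            rw [← Real.exp_nat_mul, hna, show (k : ℝ) * (-2 * (256 * (t / 100) / k)) =
              -512 * (t / 100) by field_simp; norm_num, show -514 * (t / 100) =
              -512 * (t / 100) + -2 * (t / 100) by ring, Real.exp_add]
            ring
        _ ≤ _ := by gcongr
    have h3 : (a ^ 6)⁻¹ * a ^ 100 = a ^ 94 := by field_simp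
    linarith

/-- Necessary condition (asymmetric case): there exists `D > 0` such that for all
sufficiently large `n`, if `n^(1/10) ≤ k ≤ n^(9/10)`,
`α_i, β_i ∈ [n^(-1/100), n^(1/100)]`, `m_i := α_i · (n/k)` and `n_i := β_i · (n/k)`
are positive integers, and `((m_1, n_1), …, (m_r, n_r))` is `(n, k)`-strong, then for
every `X ⊆ {1, …, r}` we have
`∑_{i ∈ X} α_i β_i + ∑_{i ∉ X} (α_i + β_i) H(p_i) ≥ D · k · log n` with
`p_i = α_i/(α_i + β_i)`. -/
theorem stmt_9 :
    ∃ D : ℝ, D > 0 ∧ ∃ N : ℕ, ∀ n : ℕ, N ≤ n →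
      ∀ k : ℕ, (n : ℝ) ^ ((1 : ℝ) / 10) ≤ (k : ℝ) → (k : ℝ) ≤ (n : ℝ) ^ ((9 : ℝ) / 10) →
      ∀ r : ℕ, ∀ α β : Fin r → ℝ, ∀ ms ns : Fin r → ℕ,
      (∀ i, (n : ℝ) ^ (-(1 : ℝ) / 100) ≤ α i ∧ α i ≤ (n : ℝ) ^ ((1 : ℝ) / 100)) →
      (∀ i, (n : ℝ) ^ (-(1 : ℝ) / 100) ≤ β i ∧ β i ≤ (n : ℝ) ^ ((1 : ℝ) / 100)) →
      (∀ i, 0 < ms i) → (∀ i, 0 < ns i) →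
      (∀ i, (ms i : ℝ) = α i * ((n : ℝ) / (k : ℝ))) →
      (∀ i, (ns i : ℝ) = β i * ((n : ℝ) / (k : ℝ))) →
      IsStrongPairs n k r ms ns →
      ∀ X : Finset (Fin r),
        (∑ i ∈ X, α i * β i) +
          (∑ i ∈ Xᶜ, (α i + β i) * binEnt (α i / (α i + β i))) ≥
            D * (k : ℝ) * Real.log n := by
  refine ⟨1 / 10000, by norm_num, 8 ^ 100, ?_⟩
  intro n hn k hk1 hk2 r α β ms ns hα hβ _ _ hms hns hstrong X
  have hn0 : (0 : ℝ) ≤ n := n.cast_nonneg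
  have hpow : ∀ m : ℕ, ((n : ℝ) ^ ((1 : ℝ) / 100)) ^ m = (n : ℝ) ^ ((m : ℝ) / 100) := fun m => by
    rw [← Real.rpow_mul_natCast hn0]; congr 1; ring
  refine strong_entropy_bound (a := (n : ℝ) ^ ((1 : ℝ) / 100)) ?_ ?_ ?_ ?_ α β ms ns ?_ ?_ hms hns
    hstrong X
  · rw [← pow_le_pow_iff_left₀ (n := 100) (by norm_num) (by positivity) (by norm_num), hpow]
    norm_num
    exact_mod_cast hn
  · rw [hpow]; norm_num
  · rw [hpow]; convert hk1 using 2; norm_num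
  · rw [hpow]; convert hk2 using 2; norm_num
  · simpa only [neg_div, Real.rpow_neg hn0] using hα
  · simpa only [neg_div, Real.rpow_neg hn0] using hβ
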